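/- For finite words u, v ∈ Σ* over a finite alphabet Σ and n ∈ ℕ_0: u ≡_{1,n}^X v if and only if u and v have the same subwords of length at most n. -/

import Mathlib

open scoped Classical

/-! ## Generalized words -/

structure GWord (A : Type) : Type 1 where
  P : Type
  ord : LinearOrder P
  w : P → A

namespace GWord

variable {A : Type}

instance (u : GWord A) : LinearOrder u.P := u.ord

/-- The set of letters occurring in a generalized word. -/
def alph (u : GWord A) : Set A := Set.range u.w

/-- Restriction of a generalized word to a set of positions. -/
def restrict (u : GWord A) (s : Set u.P) : GWord A :=
  ⟨{ p // p ∈ s }, inferInstance, fun p => u.w p.1⟩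

/-- `p` is the first `a`-labelled position of `u`. -/
def IsFirst (u : GWord A) (a : A) (p : u.P) : Prop :=
  u.w p = a ∧ ∀ q : u.P, u.w q = a → p ≤ q

/-- `p` is the last `a`-labelled position of `u`. -/
def IsLast (u : GWord A) (a : A) (p : u.P) : Prop :=
  u.w p = a ∧ ∀ q : u.P, u.w q = a → q ≤ p

/-- The factor strictly before the first occurrence of `a`. -/
noncomputable def XL (u : GWord A) (a : A) : GWord A :=
  if h : ∃ p, u.IsFirst a p then u.restrict {q | q < h.choose} else u

/-- The factor strictly after the first occurrence of `a`. -/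
noncomputable def XR (u : GWord A) (a : A) : GWord A :=
  if h : ∃ p, u.IsFirst a p then u.restrict {q | h.choose < q} else u

/-- The factor strictly before the last occurrence of `a`. -/
noncomputable def YL (u : GWord A) (a : A) : GWord A :=
  if h : ∃ p, u.IsLast a p then u.restrict {q | q < h.choose} else u

/-- The factor strictly after the last occurrence of `a`. -/
noncomputable def YR (u : GWord A) (a : A) : GWord A :=
  if h : ∃ p, u.IsLast a p then u.restrict {q | h.choose < q} else u

/-- `C_{a,b}` is defined iff the first `a` is strictly to the right of the last `b`. -/
def CDefined (u : GWord A) (a b : A) : Prop :=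
  ∃ p q, u.IsFirst a p ∧ u.IsLast b q ∧ q < p

/-- The factor strictly between the last `b` and the first `a` (junk value if undefined). -/
noncomputable def Cab (u : GWord A) (a b : A) : GWord A :=
  if h : u.CDefined a b then
    u.restrict {r | h.choose_spec.choose < r ∧ r < h.choose}
  else u

/-- Accessibility: first/last occurrences of letters after/before every position exist. -/
def Accessible (u : GWord A) : Prop :=
  (∀ a : A, (∃ p, u.w p = a) → ∃ p, u.IsFirst a p) ∧
  (∀ a : A, (∃ p, u.w p = a) → ∃ p, u.IsLast a p) ∧
  (∀ (p : u.P) (a : A), (∃ q, p < q ∧ u.w q = a) →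
    ∃ q, p < q ∧ u.w q = a ∧ ∀ r, p < r → u.w r = a → q ≤ r) ∧
  (∀ (p : u.P) (a : A), (∃ q, q < p ∧ u.w q = a) →
    ∃ q, q < p ∧ u.w q = a ∧ ∀ r, r < p → u.w r = a → r ≤ q)

/-- Concatenation of generalized words. -/
def append (u v : GWord A) : GWord A :=
  ⟨u.P ⊕ₗ v.P, inferInstance, fun x => Sum.elim u.w v.w (ofLex x)⟩

/-- The power of a generalized word by an arbitrary linear order type `ν`
(positions ordered with the exponent component dominant). -/
def gpow (u : GWord A) (ν : Type) [LinearOrder ν] : GWord A :=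
  ⟨ν ×ₗ u.P, inferInstance, fun x => u.w (ofLex x).2⟩

/-- A finite word as a generalized word. -/
def ofList (l : List A) : GWord A :=
  ⟨Fin l.length, inferInstance, fun i => l.get i⟩

end GWord

/-- The order type `ω + ω*`: a copy of `ℕ` followed by a reversed copy of `ℕ`. -/
abbrev OO : Type := ℕ ⊕ₗ ℕᵒᵈ

/-! ## The relations `≡_{m,n}^Z` -/

inductive ZK : Type
  | X | Y | WI

inductive ZKind : Type
  | X | Y | XY | WI

/-- The relations `≡_{m,n}^X`, `≡_{m,n}^Y`, `≡_{m,n}^{WI}` (first argument is `n`). -/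
def eqvAux {A : Type} : ℕ → ZK → ℕ → GWord A → GWord A → Prop
  | 0, _, _, _, _ => True
  | _ + 1, _, 0, _, _ => True
  | n + 1, ZK.X, m + 1, u, v =>
      u.alph = v.alph ∧ eqvAux n ZK.Y m u v ∧
      ∀ a ∈ u.alph, eqvAux n ZK.Y m (u.XL a) (v.XL a) ∧
        eqvAux n ZK.X (m + 1) (u.XR a) (v.XR a)
  | n + 1, ZK.Y, m + 1, u, v =>
      u.alph = v.alph ∧ eqvAux n ZK.X m u v ∧
      ∀ a ∈ u.alph, eqvAux n ZK.Y (m + 1) (u.YL a) (v.YL a) ∧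
        eqvAux n ZK.X m (u.YR a) (v.YR a)
  | n + 1, ZK.WI, m + 1, u, v =>
      u.alph = v.alph ∧
      (∀ a ∈ u.alph,
        eqvAux n ZK.WI m (u.XL a) (v.XL a) ∧ eqvAux n ZK.WI (m + 1) (u.XR a) (v.XR a) ∧
        eqvAux n ZK.WI (m + 1) (u.YL a) (v.YL a) ∧ eqvAux n ZK.WI m (u.YR a) (v.YR a)) ∧
      ∀ a ∈ u.alph, ∀ b ∈ u.alph,
        (u.CDefined a b ↔ v.CDefined a b) ∧
        (u.CDefined a b → v.CDefined a b → eqvAux n ZK.WI m (u.Cab a b) (v.Cab a b))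

/-- `wEquiv Z m n u v` is `u ≡_{m,n}^Z v`. -/
def wEquiv {A : Type} (Z : ZKind) (m n : ℕ) (u v : GWord A) : Prop :=
  match Z with
  | ZKind.X => eqvAux n ZK.X m u v
  | ZKind.Y => eqvAux n ZK.Y m u v
  | ZKind.XY => eqvAux n ZK.X m u v ∧ eqvAux n ZK.Y m u v
  | ZKind.WI => eqvAux n ZK.WI m u v

/-! ## π-terms -/

inductive PiTerm (A : Type) : Type
  | eps : PiTerm A
  | letter : A → PiTerm A
  | mul : PiTerm A → PiTerm A → PiTerm A
  | pi : PiTerm A → PiTerm A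

def listNPow {A : Type} (l : List A) : ℕ → List A
  | 0 => []
  | k + 1 => l ++ listNPow l k

/-- `[γ]_k`: substitute the natural number `k` for the formal power `π`. -/
def PiTerm.substNat {A : Type} : PiTerm A → ℕ → List A
  | .eps, _ => []
  | .letter a, _ => [a]
  | .mul α β, k => α.substNat k ++ β.substNat k
  | .pi γ, k => listNPow (γ.substNat k) k

/-- `[γ]_{ω+ω*}`: substitute the order type `ω + ω*` for the formal power `π`. -/
def PiTerm.substOO {A : Type} : PiTerm A → GWord A
  | .eps => GWord.ofList []
  | .letter a => GWord.ofList [a]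
  | .mul α β => α.substOO.append β.substOO
  | .pi γ => γ.substOO.gpow OO

/-! ## Finite monoids, equations, the Trotter–Weil hierarchy -/

/-- `M!`: the exponent of a finite monoid, the least `n ≥ 1` such that all `x^n` are
idempotent. -/
noncomputable def monoidExp (M : Type) [Monoid M] : ℕ :=
  sInf {n : ℕ | 1 ≤ n ∧ ∀ x : M, IsIdempotentElem (x ^ n)}

/-- The equation `α = β` of π-terms holds in the finite monoid `M`. -/
def EqHoldsIn {A : Type} (α β : PiTerm A) (M : Type) [Monoid M] : Prop :=
  ∀ σ : FreeMonoid A →* M,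
    σ (FreeMonoid.ofList (α.substNat (monoidExp M))) =
      σ (FreeMonoid.ofList (β.substNat (monoidExp M)))

/-- Green's relation `R`: `x R y` iff `xM = yM`. -/
def rGreen {M : Type} [Monoid M] (x y : M) : Prop :=
  Set.range (fun z => x * z) = Set.range (fun z => y * z)

/-- Green's relation `L`: `x L y` iff `Mx = My`. -/
def lGreen {M : Type} [Monoid M] (x y : M) : Prop :=
  Set.range (fun z => z * x) = Set.range (fun z => z * y)

/-- `J`-triviality: `MxM = MyM` implies `x = y`. -/
def IsJTrivial (M : Type) [Monoid M] : Prop :=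
  ∀ x y : M, {z | ∃ a b, z = a * x * b} = {z | ∃ a b, z = a * y * b} → x = y

/-- The relation `∼_K`. -/
def simK {M : Type} [Monoid M] (x y : M) : Prop :=
  ∀ e : M, IsIdempotentElem e → (rGreen (e * x) e ∨ rGreen (e * y) e) → e * x = e * y

/-- The relation `∼_D`. -/
def simD {M : Type} [Monoid M] (x y : M) : Prop :=
  ∀ e : M, IsIdempotentElem e → (lGreen (x * e) e ∨ lGreen (y * e) e) → x * e = y * e

/-- `∼_K` as a congruence (it is a congruence, so `conGen` does not change it). -/
def KCon (M : Type) [Monoid M] : Con M := conGen simK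

/-- `∼_D` as a congruence. -/
def DCon (M : Type) [Monoid M] : Con M := conGen simD

/-- `InRLAux k true M _ = (M ∈ R_{k+1})` and `InRLAux k false M _ = (M ∈ L_{k+1})`. -/
def InRLAux : ℕ → Bool → (M : Type) → Monoid M → Prop
  | 0, _, M, i => letI := i; IsJTrivial M
  | k + 1, true, M, i => letI := i; InRLAux k false (KCon M).Quotient inferInstance
  | k + 1, false, M, i => letI := i; InRLAux k true (DCon M).Quotient inferInstance

/-- `M ∈ R_m` (for `m ≥ 1`). -/
def InRm (m : ℕ) (M : Type) [i : Monoid M] : Prop := InRLAux (m - 1) true M i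

/-- `M ∈ L_m` (for `m ≥ 1`). -/
def InLm (m : ℕ) (M : Type) [i : Monoid M] : Prop := InRLAux (m - 1) false M i

/-- `N` divides `M`: `N` is a homomorphic image of a submonoid of `M`. -/
def MDivides (N M : Type) [Monoid N] [Monoid M] : Prop :=
  ∃ (S : Submonoid M) (f : S →* N), Function.Surjective f

/-- `N ∈ R_m ∨ L_m`: `N` divides a direct product `M₁ × M₂` with `M₁ ∈ R_m`, `M₂ ∈ L_m`. -/
def InJoin (m : ℕ) (N : Type) [Monoid N] : Prop :=
  ∃ (M₁ M₂ : Type) (i₁ : Monoid M₁) (i₂ : Monoid M₂),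
    letI := i₁; letI := i₂;
    Finite M₁ ∧ Finite M₂ ∧ InRm m M₁ ∧ InLm m M₂ ∧ MDivides N (M₁ × M₂)

/-- `M ∈ DA`, via the equation `(xyz)^{M!} y (xyz)^{M!} = (xyz)^{M!}`. -/
def InDA (M : Type) [Monoid M] : Prop :=
  ∀ x y z : M,
    (x * y * z) ^ monoidExp M * y * (x * y * z) ^ monoidExp M = (x * y * z) ^ monoidExp M

/-! ## The π-terms `U_m`, `V_m` -/

inductive UVLetter : Type
  | s | t | x (i : ℕ) | y (i : ℕ)

/-- `U_m` (indexed from 1; `Uterm 0` is a junk value). -/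
def Uterm : ℕ → PiTerm UVLetter
  | 0 => PiTerm.eps
  | 1 =>
      PiTerm.mul
        (PiTerm.pi (PiTerm.mul (PiTerm.letter UVLetter.s) (PiTerm.letter (UVLetter.x 1))))
        (PiTerm.mul (PiTerm.letter UVLetter.s)
          (PiTerm.pi (PiTerm.mul (PiTerm.letter (UVLetter.y 1)) (PiTerm.letter UVLetter.t))))
  | m + 2 =>
      PiTerm.mul
        (PiTerm.pi (PiTerm.mul (Uterm (m + 1)) (PiTerm.letter (UVLetter.x (m + 2)))))
        (PiTerm.mul (Uterm (m + 1))
          (PiTerm.pi (PiTerm.mul (PiTerm.letter (UVLetter.y (m + 2))) (Uterm (m + 1)))))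

/-- `V_m` (indexed from 1; `Vterm 0` is a junk value). -/
def Vterm : ℕ → PiTerm UVLetter
  | 0 => PiTerm.eps
  | 1 =>
      PiTerm.mul
        (PiTerm.pi (PiTerm.mul (PiTerm.letter UVLetter.s) (PiTerm.letter (UVLetter.x 1))))
        (PiTerm.mul (PiTerm.letter UVLetter.t)
          (PiTerm.pi (PiTerm.mul (PiTerm.letter (UVLetter.y 1)) (PiTerm.letter UVLetter.t))))
  | m + 2 =>
      PiTerm.mul
        (PiTerm.pi (PiTerm.mul (Uterm (m + 1)) (PiTerm.letter (UVLetter.x (m + 2)))))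
        (PiTerm.mul (Vterm (m + 1))
          (PiTerm.pi (PiTerm.mul (PiTerm.letter (UVLetter.y (m + 2))) (Uterm (m + 1)))))

/-- The relation `≡_{m,n}^Z` on the free monoid `Σ*`, as a congruence
(it is a congruence, so `conGen` does not change it). -/
def eqvCon (A : Type) (Z : ZKind) (m n : ℕ) : Con (FreeMonoid A) :=
  conGen (fun u v => wEquiv Z m n (GWord.ofList u.toList) (GWord.ofList v.toList))

namespace GWord

variable {A : Type}

/-- `w` is a (scattered) subword of the generalized word `u`. -/
def HasSubword (u : GWord A) (w : List A) : Prop :=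
  ∃ ps : List u.P, ps.Pairwise (· < ·) ∧ ps.map u.w = w

theorem hasSubword_nil (u : GWord A) : u.HasSubword [] := ⟨[], by simp⟩

theorem hasSubword_singleton {u : GWord A} {a : A} : u.HasSubword [a] ↔ a ∈ u.alph := by
  constructor
  · rintro ⟨ps, -, h⟩
    obtain ⟨p, -, hp⟩ := List.mem_map.1 (h ▸ List.mem_singleton_self a : a ∈ ps.map u.w)
    exact ⟨p, hp⟩
  · rintro ⟨p, rfl⟩
    exact ⟨[p], by simp⟩

theorem hasSubword_restrict {u : GWord A} {s : Set u.P} {w : List A} :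
    (u.restrict s).HasSubword w ↔
      ∃ ps : List u.P, (∀ p ∈ ps, p ∈ s) ∧ ps.Pairwise (· < ·) ∧ ps.map u.w = w := by
  constructor
  · rintro ⟨ps, hlt, rfl⟩
    refine ⟨ps.map Subtype.val, ?_, ?_, ?_⟩
    · intro p hp
      obtain ⟨q, -, rfl⟩ := List.mem_map.1 hp
      exact q.2
    · exact List.pairwise_map.2 hlt
    · exact List.map_map
  · rintro ⟨ps, hs, hlt, rfl⟩
    lift ps to List {p // p ∈ s} using hs
    exact ⟨ps, (List.pairwise_map (f := Subtype.val)).1 hlt,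
      (List.map_map (g := u.w) (f := Subtype.val) (l := ps)).symm⟩

theorem XR_eq_restrict {u : GWord A} {a : A} {p : u.P} (hp : u.IsFirst a p) :
    u.XR a = u.restrict {q | p < q} := by
  have h : ∃ p, u.IsFirst a p := ⟨p, hp⟩
  have hc : h.choose = p :=
    le_antisymm (h.choose_spec.2 p hp.1) (hp.2 _ h.choose_spec.1)
  rw [XR, dif_pos h, hc]

theorem exists_isFirst {u : GWord A} [Finite u.P] {a : A} (ha : a ∈ u.alph) :
    ∃ p, u.IsFirst a p := by
  obtain ⟨p, hp, hmin⟩ := Set.exists_min_image {p | u.w p = a} id (Set.toFinite _) ha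
  exact ⟨p, hp, hmin⟩

instance (u : GWord A) [Finite u.P] (a : A) : Finite (u.XR a).P := by
  unfold XR
  split_ifs
  · exact Subtype.finite
  · assumption

theorem hasSubword_cons {u : GWord A} [Finite u.P] {a : A} {w : List A} :
    u.HasSubword (a :: w) ↔ a ∈ u.alph ∧ (u.XR a).HasSubword w := by
  constructor
  · rintro ⟨_ | ⟨q, ps⟩, hlt, h⟩
    · simp at h
    obtain ⟨hq, hw⟩ := List.cons.inj h
    have ha : a ∈ u.alph := ⟨q, hq⟩
    obtain ⟨p, hp⟩ := exists_isFirst ha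
    rw [XR_eq_restrict hp, hasSubword_restrict]
    rw [List.pairwise_cons] at hlt
    exact ⟨ha, ps, fun r hr => (hp.2 q hq).trans_lt (hlt.1 r hr), hlt.2, hw⟩
  · rintro ⟨ha, h⟩
    obtain ⟨p, hp⟩ := exists_isFirst ha
    rw [XR_eq_restrict hp, hasSubword_restrict] at h
    obtain ⟨ps, hs, hlt, rfl⟩ := h
    exact ⟨p :: ps, List.pairwise_cons.2 ⟨hs, hlt⟩, by rw [List.map_cons, hp.1]⟩

theorem hasSubword_ofList {l w : List A} : (ofList l).HasSubword w ↔ w.Sublist l := by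
  constructor
  · rintro ⟨ps, hlt, rfl⟩
    exact List.map_getElem_sublist hlt
  · intro h
    obtain ⟨ps, hw, hlt⟩ := List.sublist_eq_map_getElem h
    exact ⟨ps, hlt, hw.symm⟩

end GWord

theorem eqvAux_zero_right {A : Type} (n : ℕ) (k : ZK) (u v : GWord A) : eqvAux n k 0 u v := by
  cases n <;> simp [eqvAux]

theorem eqvAux_X_one_iff {A : Type} (n : ℕ) (u v : GWord A) [Finite u.P] [Finite v.P] :
    eqvAux n ZK.X 1 u v ↔ ∀ w : List A, w.length ≤ n → (u.HasSubword w ↔ v.HasSubword w) := by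
  induction n generalizing u v with
  | zero =>
    simp [eqvAux, GWord.hasSubword_nil]
  | succ n ih =>
    simp only [eqvAux, eqvAux_zero_right, true_and, zero_add, ih]
    constructor
    · rintro ⟨halph, hR⟩ (_ | ⟨a, w⟩) hw
      · simp only [GWord.hasSubword_nil]
      · rw [GWord.hasSubword_cons, GWord.hasSubword_cons, ← halph]
        exact and_congr_right fun ha => hR a ha w (Nat.le_of_succ_le_succ hw)
    · intro h
      have halph : u.alph = v.alph := by
        ext a
        rw [← GWord.hasSubword_singleton, ← GWord.hasSubword_singleton]
        exact h [a] (by simp)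
      refine ⟨halph, fun a ha w hw => ?_⟩
      have := h (a :: w) (Nat.succ_le_succ hw)
      rw [GWord.hasSubword_cons, GWord.hasSubword_cons] at this
      simpa [ha, halph ▸ ha] using this

/-- `≡_{1,n}^X` is the relation of having the same subwords of length at most `n`. -/
theorem equiv_one_n_X_iff_subwords (A : Type) [Fintype A] (n : ℕ) (u v : List A) :
    wEquiv ZKind.X 1 n (GWord.ofList u) (GWord.ofList v) ↔
      ∀ w : List A, w.length ≤ n → (w.Sublist u ↔ w.Sublist v) := by
  have (l : List A) : Finite (GWord.ofList l).P := inferInstanceAs (Finite (Fin l.length))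
  simp only [wEquiv, eqvAux_X_one_iff, GWord.hasSubword_ofList]
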